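/- (Lemma 4.1: the radial weak momentum identity extends to test functions up to the origin) Let 0 ≤ t₁ < t₂, R > 0, K > 0, ν > 0. Let ρ, θ : [t₁,t₂] × (0,R] → [0,∞) and f : [t₁,t₂] × (0,R] → ℝ be measurable, and let u : [t₁,t₂] × (0,R] → ℝ be continuous with u(t,·) continuously differentiable on (0,R] for each t, satisfying: sup_{t ∈ [t₁,t₂]} ∫_0^R ρ·(1 + u² + θ)(t,r) r dr < ∞; ∫_{t₁}^{t₂} ∫_0^R ( |u_r|^{4/3} + |u/r|^{4/3} ) r dr dt < ∞; and ∫_{t₁}^{t₂} ∫_0^R ρ·|f| r dr dt < ∞. Suppose that for every b > 0 and every C¹ function ψ on [t₁,t₂] × [0,R] vanishing for r ∈ [0,b] and satisfying ψ(t,R) = 0, the identity holds: [∫_0^R ρuψ r dr]_{t=t₁}^{t=t₂} − ∫_{t₁}^{t₂} ∫_0^R [ ρu·ψ_t + ρu²·ψ_r + Kρθ·(ψ_r + ψ/r) ] r dr dt = ∫_{t₁}^{t₂} ∫_0^R ρfψ r dr dt − ν·∫_{t₁}^{t₂} ∫_0^R (u_r + u/r)·(ψ_r + ψ/r) r dr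 dt. Then the same identity holds for every C¹ function φ on [t₁,t₂] × [0,R] with φ(t,0) = φ(t,R) = 0 for all t ∈ [t₁,t₂]. -/

import Mathlib

noncomputable section
open MeasureTheory Set

/-- The weak form of the radial momentum equation tested against `ψ` on
`[t₁,t₂] × (0,R]`, with pressure `P = Kρθ` and effective viscosity `ν`. -/
def momentumWeakForm (t₁ t₂ R K ν : ℝ) (ρ θ f u ur : ℝ → ℝ → ℝ) (ψ : ℝ × ℝ → ℝ) : Prop :=
  ((∫ r in (0:ℝ)..R, ρ t₂ r * u t₂ r * ψ (t₂, r) * r)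
      - ∫ r in (0:ℝ)..R, ρ t₁ r * u t₁ r * ψ (t₁, r) * r)
    - (∫ t in t₁..t₂, ∫ r in (0:ℝ)..R,
        (ρ t r * u t r * deriv (fun s => ψ (s, r)) t
          + ρ t r * (u t r) ^ 2 * deriv (fun x => ψ (t, x)) r
          + K * ρ t r * θ t r * (deriv (fun x => ψ (t, x)) r + ψ (t, r) / r)) * r)
  = (∫ t in t₁..t₂, ∫ r in (0:ℝ)..R, ρ t r * f t r * ψ (t, r) * r)
    - ν * ∫ t in t₁..t₂, ∫ r in (0:ℝ)..R,
        (ur t r + u t r / r) * (deriv (fun x => ψ (t, x)) r + ψ (t, r) / r) * r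

open Filter Topology

namespace RadialMomentum

lemma hasDerivAt_fst_slice {φ : ℝ × ℝ → ℝ} (hφ : ContDiff ℝ 1 φ) (t r : ℝ) :
    HasDerivAt (fun s => φ (s, r)) (fderiv ℝ φ (t, r) (1, 0)) t :=
  ((hφ.differentiable one_ne_zero) (t, r)).hasFDerivAt.comp_hasDerivAt t
    ((hasDerivAt_id t).prodMk (hasDerivAt_const t r))

lemma hasDerivAt_snd_slice {φ : ℝ × ℝ → ℝ} (hφ : ContDiff ℝ 1 φ) (t r : ℝ) :
    HasDerivAt (fun x => φ (t, x)) (fderiv ℝ φ (t, r) (0, 1)) r :=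
  ((hφ.differentiable one_ne_zero) (t, r)).hasFDerivAt.comp_hasDerivAt r
    ((hasDerivAt_const r t).prodMk (hasDerivAt_id r))

lemma continuous_deriv_fst_slice {φ : ℝ × ℝ → ℝ} (hφ : ContDiff ℝ 1 φ) :
    Continuous fun q : ℝ × ℝ => deriv (fun s => φ (s, q.2)) q.1 := by
  simp_rw [fun q : ℝ × ℝ => (hasDerivAt_fst_slice hφ q.1 q.2).deriv]
  exact (hφ.continuous_fderiv one_ne_zero).clm_apply continuous_const

lemma continuous_deriv_snd_slice {φ : ℝ × ℝ → ℝ} (hφ : ContDiff ℝ 1 φ) :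
    Continuous fun q : ℝ × ℝ => deriv (fun x => φ (q.1, x)) q.2 := by
  simp_rw [fun q : ℝ × ℝ => (hasDerivAt_snd_slice hφ q.1 q.2).deriv]
  exact (hφ.continuous_fderiv one_ne_zero).clm_apply continuous_const

/-- A `C¹` function vanishing on `{r = 0}` has bounded derivatives and grows at most linearly
in `r` on a bounded cylinder. -/
lemma exists_bound_of_vanishing_at_zero {φ : ℝ × ℝ → ℝ} (hφ : ContDiff ℝ 1 φ)
    {t₁ t₂ R : ℝ} (h0 : ∀ t ∈ Icc t₁ t₂, φ (t, 0) = 0) :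
    ∃ C, 0 ≤ C ∧ ∀ t ∈ Icc t₁ t₂, ∀ r ∈ Icc 0 R, |φ (t, r)| ≤ C * r ∧
      |deriv (fun s => φ (s, r)) t| ≤ C ∧ |deriv (fun x => φ (t, x)) r| ≤ C := by
  have hK : IsCompact (Icc t₁ t₂ ×ˢ Icc 0 R) := isCompact_Icc.prod isCompact_Icc
  obtain ⟨C₁, hC₁⟩ := hK.exists_bound_of_continuousOn (continuous_deriv_fst_slice hφ).continuousOn
  obtain ⟨C₂, hC₂⟩ := hK.exists_bound_of_continuousOn (continuous_deriv_snd_slice hφ).continuousOn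
  refine ⟨max (max C₁ C₂) 0, le_max_right _ _, fun t ht r hr => ⟨?_, ?_, ?_⟩⟩
  · have hmv := (convex_Icc (0 : ℝ) R).norm_image_sub_le_of_norm_hasDerivWithin_le
      (f := fun x => φ (t, x)) (f' := fun x => deriv (fun y => φ (t, y)) x)
      (C := max (max C₁ C₂) 0) (x := 0) (y := r)
      (fun x _ => (hasDerivAt_snd_slice hφ t x).differentiableAt.hasDerivAt.hasDerivWithinAt)
      (fun x hx => (hC₂ (t, x) ⟨ht, hx⟩).trans ((le_max_right _ _).trans (le_max_left _ _)))
      ⟨le_rfl, hr.1.trans hr.2⟩ hr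
    simpa [h0 t ht, abs_of_nonneg hr.1] using hmv
  · exact (hC₁ (t, r) ⟨ht, hr⟩).trans ((le_max_left _ _).trans (le_max_left _ _))
  · exact (hC₂ (t, r) ⟨ht, hr⟩).trans ((le_max_right _ _).trans (le_max_left _ _))

/-- Smooth cutoffs near the origin approximate a `C¹` function vanishing at `r = 0`, with
first derivatives and `ψ / r` bounded uniformly. -/
lemma exists_cutoff_approximation {φ : ℝ × ℝ → ℝ} (hφ : ContDiff ℝ 1 φ)
    {t₁ t₂ R : ℝ} (h0 : ∀ t ∈ Icc t₁ t₂, φ (t, 0) = 0) :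
    ∃ (ψ : ℕ → ℝ × ℝ → ℝ) (M : ℝ), 0 ≤ M ∧ (∀ n, ContDiff ℝ 1 (ψ n)) ∧
      (∀ n : ℕ, ∀ t, ∀ r ∈ Icc (0 : ℝ) (1 / ((n : ℝ) + 1)), ψ n (t, r) = 0) ∧
      (∀ n q, φ q = 0 → ψ n q = 0) ∧
      (∀ n, ∀ t ∈ Icc t₁ t₂, ∀ r ∈ Icc 0 R, |ψ n (t, r)| ≤ M * r ∧
        |deriv (fun s => ψ n (s, r)) t| ≤ M ∧ |deriv (fun x => ψ n (t, x)) r| ≤ M) ∧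
      (∀ r, 0 < r → ∀ᶠ n in atTop, ∀ t, ψ n (t, r) = φ (t, r) ∧
        deriv (fun s => ψ n (s, r)) t = deriv (fun s => φ (s, r)) t ∧
        deriv (fun x => ψ n (t, x)) r = deriv (fun x => φ (t, x)) r) := by
  obtain ⟨C, hC0, hC⟩ := exists_bound_of_vanishing_at_zero (R := R) hφ h0
  let χ : ContDiffBump (0 : ℝ) := ⟨1, 2, one_pos, one_lt_two⟩
  have hχd : ∀ x, HasDerivAt χ (deriv χ x) x := fun x =>
    ((χ.contDiff (n := 1)).differentiable one_ne_zero x).hasDerivAt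
  obtain ⟨D, hD⟩ : ∃ D, ∀ x, ‖x * deriv χ x‖ ≤ D :=
    (χ.hasCompactSupport.deriv.mul_left (f := fun x : ℝ => x)).exists_bound_of_continuous
      (continuous_id.mul ((χ.contDiff (n := 1)).continuous_deriv le_rfl))
  have hD0 : 0 ≤ D := (norm_nonneg _).trans (hD 0)
  have habs : ∀ x, |1 - χ x| ≤ 1 := fun x => by
    rw [abs_le]
    constructor <;> linarith [χ.nonneg (x := x), χ.le_one (x := x)]
  have hderiv : ∀ (n : ℕ) (t r : ℝ), HasDerivAt
      (fun x => (1 - χ (((n : ℝ) + 1) * x)) * φ (t, x))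
      (-(deriv χ (((n : ℝ) + 1) * r) * ((n : ℝ) + 1)) * φ (t, r)
        + (1 - χ (((n : ℝ) + 1) * r)) * deriv (fun x => φ (t, x)) r) r := by
    intro n t r
    have hlin : HasDerivAt (fun x : ℝ => ((n : ℝ) + 1) * x) ((n : ℝ) + 1) r := by
      simpa using (hasDerivAt_id r).const_mul ((n : ℝ) + 1)
    exact (((hχd _).comp r hlin).const_sub 1).mul
      (hasDerivAt_snd_slice hφ t r).differentiableAt.hasDerivAt
  have hderiv_fst : ∀ (n : ℕ) (t r : ℝ), deriv
      (fun s => (1 - χ (((n : ℝ) + 1) * r)) * φ (s, r)) t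
      = (1 - χ (((n : ℝ) + 1) * r)) * deriv (fun s => φ (s, r)) t := fun n t r =>
    deriv_const_mul _ (hasDerivAt_fst_slice hφ t r).differentiableAt
  refine ⟨fun n q => (1 - χ (((n : ℝ) + 1) * q.2)) * φ q, C * (D + 1), by positivity,
    fun n => ?_, fun n t r hr => ?_, fun n q hq => by simp [hq], fun n t ht r hr => ?_,
    fun r hr => ?_⟩
  · exact (contDiff_const.sub (χ.contDiff.comp (contDiff_const.mul contDiff_snd))).mul hφ
  · have hn : (0 : ℝ) < (n : ℝ) + 1 := by positivity
    have hr' : ((n : ℝ) + 1) * r ≤ 1 := by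
      have := (le_div_iff₀ hn).1 hr.2
      linarith
    have : χ (((n : ℝ) + 1) * r) = 1 := by
      apply χ.one_of_mem_closedBall
      rw [mem_closedBall_zero_iff, Real.norm_eq_abs, abs_of_nonneg (mul_nonneg hn.le hr.1)]
      exact hr'
    simp [this]
  · obtain ⟨h₁, h₂, h₃⟩ := hC t ht r hr
    have hχ := habs (((n : ℝ) + 1) * r)
    have hCD : C ≤ C * (D + 1) := by nlinarith
    refine ⟨?_, ?_, ?_⟩
    · rw [abs_mul]
      calc _ ≤ 1 * (C * r) := mul_le_mul hχ h₁ (abs_nonneg _) zero_le_one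
        _ ≤ C * (D + 1) * r := by rw [one_mul]; exact mul_le_mul_of_nonneg_right hCD hr.1
    · rw [hderiv_fst, abs_mul]
      calc _ ≤ 1 * C := mul_le_mul hχ h₂ (abs_nonneg _) zero_le_one
        _ ≤ C * (D + 1) := by rwa [one_mul]
    · rw [(hderiv n t r).deriv]
      have hfirst : |-(deriv χ (((n : ℝ) + 1) * r) * ((n : ℝ) + 1)) * φ (t, r)| ≤ D * C := by
        have hn : (0 : ℝ) ≤ (n : ℝ) + 1 := by positivity
        have hDr : |deriv χ (((n : ℝ) + 1) * r) * ((n : ℝ) + 1)| * r ≤ D := by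
          refine le_trans (le_of_eq ?_) (hD (((n : ℝ) + 1) * r))
          rw [Real.norm_eq_abs, abs_mul, abs_mul, abs_mul, abs_of_nonneg hr.1]
          ring
        rw [abs_mul, abs_neg]
        calc _ ≤ |deriv χ (((n : ℝ) + 1) * r) * ((n : ℝ) + 1)| * (C * r) :=
              mul_le_mul_of_nonneg_left h₁ (abs_nonneg _)
          _ = |deriv χ (((n : ℝ) + 1) * r) * ((n : ℝ) + 1)| * r * C := by ring
          _ ≤ D * C := mul_le_mul_of_nonneg_right hDr hC0
      have hsecond : |(1 - χ (((n : ℝ) + 1) * r)) * deriv (fun x => φ (t, x)) r| ≤ 1 * C := by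
        rw [abs_mul]
        exact mul_le_mul hχ h₃ (abs_nonneg _) zero_le_one
      calc _ ≤ D * C + 1 * C := (abs_add_le _ _).trans (add_le_add hfirst hsecond)
        _ = C * (D + 1) := by ring
  · have hlarge : ∀ᶠ n : ℕ in atTop, 2 < ((n : ℝ) + 1) * r :=
      ((tendsto_atTop_add_const_right _ 1 tendsto_natCast_atTop_atTop).atTop_mul_const
        hr).eventually_gt_atTop 2
    filter_upwards [hlarge] with n hn t
    have hχ0 : ∀ x, 2 < x → χ x = 0 := fun x hx => by
      apply χ.zero_of_le_dist
      rw [dist_zero_right, Real.norm_eq_abs]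
      exact hx.le.trans (le_abs_self x)
    have hlocal : (fun x => (1 - χ (((n : ℝ) + 1) * x)) * φ (t, x)) =ᶠ[𝓝 r]
        fun x => φ (t, x) := by
      filter_upwards [(continuous_const_mul ((n : ℝ) + 1)).continuousAt.eventually_const_lt hn]
        with x hx
      rw [hχ0 _ hx, sub_zero, one_mul]
    refine ⟨hlocal.self_of_nhds, ?_, hlocal.deriv_eq⟩
    rw [hderiv_fst, hχ0 _ hn, sub_zero, one_mul]

/-- Dominated convergence for iterated interval integrals. -/
lemma tendsto_iterated_integral {a b c d : ℝ} (hab : a ≤ b) (hcd : c ≤ d)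
    {F : ℕ → ℝ × ℝ → ℝ} {G bound : ℝ × ℝ → ℝ}
    (hF : ∀ n, AEStronglyMeasurable (F n) (volume.restrict (Ioc a b ×ˢ Ioc c d)))
    (hbound : IntegrableOn bound (Ioc a b ×ˢ Ioc c d))
    (hle : ∀ n, ∀ q ∈ Ioc a b ×ˢ Ioc c d, ‖F n q‖ ≤ bound q)
    (hlim : ∀ q ∈ Ioc a b ×ˢ Ioc c d, ∀ᶠ n in atTop, F n q = G q) :
    Tendsto (fun n => ∫ t in a..b, ∫ r in c..d, F n (t, r)) atTop
      (𝓝 (∫ t in a..b, ∫ r in c..d, G (t, r))) := by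
  have hS : MeasurableSet (Ioc a b ×ˢ Ioc c d) := measurableSet_Ioc.prod measurableSet_Ioc
  have hlim' : ∀ᵐ q ∂(volume.restrict (Ioc a b ×ˢ Ioc c d)),
      Tendsto (fun n => F n q) atTop (𝓝 (G q)) :=
    ae_restrict_of_forall_mem hS fun q hq => tendsto_nhds_of_eventually_eq (hlim q hq)
  have hGm := aestronglyMeasurable_of_tendsto_ae _ hF hlim'
  have hGi : IntegrableOn G (Ioc a b ×ˢ Ioc c d) :=
    hbound.mono' hGm <| ae_restrict_of_forall_mem hS fun q hq => by
      obtain ⟨n, hn⟩ := (hlim q hq).exists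
      exact hn ▸ hle n q hq
  have hFi : ∀ n, IntegrableOn (F n) (Ioc a b ×ˢ Ioc c d) := fun n =>
    hbound.mono' (hF n) (ae_restrict_of_forall_mem hS (hle n))
  have hiter : ∀ H : ℝ × ℝ → ℝ, IntegrableOn H (Ioc a b ×ˢ Ioc c d) →
      ∫ t in a..b, ∫ r in c..d, H (t, r) = ∫ q in Ioc a b ×ˢ Ioc c d, H q := fun H hH => by
    simp_rw [intervalIntegral.integral_of_le hab, intervalIntegral.integral_of_le hcd]
    exact (setIntegral_prod H hH).symm
  simp_rw [fun n => hiter (F n) (hFi n), hiter G hGi]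
  exact tendsto_integral_of_dominated_convergence bound hF hbound
    (fun n => ae_restrict_of_forall_mem hS (hle n)) hlim'

/-- The spatial derivative of a jointly continuous function is jointly measurable. -/
lemma aestronglyMeasurable_spatial_deriv {t₁ t₂ R : ℝ} {u ur : ℝ → ℝ → ℝ}
    (huc : ContinuousOn (Function.uncurry u) (Icc t₁ t₂ ×ˢ Ioc 0 R))
    (hur : ∀ t ∈ Icc t₁ t₂, ∀ r ∈ Ioc (0 : ℝ) R, HasDerivAt (fun x => u t x) (ur t r) r) :
    AEStronglyMeasurable (Function.uncurry ur) (volume.restrict (Ioc t₁ t₂ ×ˢ Ioc 0 R)) := by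
  have hS : MeasurableSet (Icc t₁ t₂ ×ˢ Ioc 0 R) := measurableSet_Icc.prod measurableSet_Ioc
  have hrestrict : (volume : Measure (ℝ × ℝ)).restrict (Ioc t₁ t₂ ×ˢ Ioc 0 R)
      = volume.restrict (Ioc t₁ t₂ ×ˢ Ioo 0 R) :=
    Measure.restrict_congr_set
      (Measure.set_prod_ae_eq (μ := (volume : Measure ℝ)) (ν := (volume : Measure ℝ))
        EventuallyEq.rfl Ioo_ae_eq_Ioc.symm)
  rw [hrestrict]
  classical
  have hv : Measurable ((Icc t₁ t₂ ×ˢ Ioc 0 R).piecewise (Function.uncurry u) 0) :=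
    huc.measurable_piecewise continuousOn_const hS
  set v := (Icc t₁ t₂ ×ˢ Ioc 0 R).piecewise (Function.uncurry u) 0 with hvdef
  refine aestronglyMeasurable_of_tendsto_ae (u := atTop)
    (f := fun (n : ℕ) (q : ℝ × ℝ) =>
      (1 / ((n : ℝ) + 1))⁻¹ • (v (q.1, q.2 + 1 / ((n : ℝ) + 1)) - v q)) (fun n => ?_) ?_
  · have hshift : Measurable fun q : ℝ × ℝ => v (q.1, q.2 + 1 / ((n : ℝ) + 1)) :=
      hv.comp (measurable_fst.prodMk (measurable_snd.add_const _))
    exact ((hshift.sub hv).const_smul (1 / ((n : ℝ) + 1))⁻¹).aestronglyMeasurable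
  · refine ae_restrict_of_forall_mem (measurableSet_Ioc.prod measurableSet_Ioo) ?_
    rintro ⟨t, r⟩ ⟨ht, hr⟩
    have ht' : t ∈ Icc t₁ t₂ := Ioc_subset_Icc_self ht
    have hr' : r ∈ Ioc 0 R := Ioo_subset_Ioc_self hr
    have hstep : Tendsto (fun n : ℕ => 1 / ((n : ℝ) + 1)) atTop (𝓝[≠] 0) :=
      tendsto_nhdsWithin_iff.2 ⟨tendsto_one_div_add_atTop_nhds_zero_nat,
        Eventually.of_forall fun n => (Nat.one_div_pos_of_nat (α := ℝ)).ne'⟩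
    refine (((hur t ht' r hr').tendsto_slope_zero).comp hstep).congr' ?_
    filter_upwards [tendsto_one_div_add_atTop_nhds_zero_nat.eventually_lt_const
      (sub_pos.2 hr.2)] with n hn
    have hpos : 0 < 1 / ((n : ℝ) + 1) := Nat.one_div_pos_of_nat
    have hmem : (t, r + 1 / ((n : ℝ) + 1)) ∈ Icc t₁ t₂ ×ˢ Ioc 0 R :=
      ⟨ht', add_pos hr.1 hpos, by linarith⟩
    simp only [Function.comp_apply, hvdef, piecewise_eq_of_mem _ _ _ hmem,
      piecewise_eq_of_mem _ _ _ (show (t, r) ∈ Icc t₁ t₂ ×ˢ Ioc 0 R from ⟨ht', hr'⟩),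
      Function.uncurry_apply_pair]

/-- A nonnegative density with uniformly bounded spatial integrals is integrable in
space-time. -/
lemma integrableOn_prod_of_slice_bound {t₁ t₂ R A : ℝ} {E : ℝ × ℝ → ℝ}
    (hE : AEStronglyMeasurable E (volume.restrict (Ioc t₁ t₂ ×ˢ Ioc 0 R)))
    (h0 : ∀ t ∈ Ioc t₁ t₂, ∀ r ∈ Ioc 0 R, 0 ≤ E (t, r))
    (hslice : ∀ t ∈ Ioc t₁ t₂, IntegrableOn (fun r => E (t, r)) (Ioc 0 R) ∧
      ∫ r in Ioc 0 R, E (t, r) ≤ A) :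
    IntegrableOn E (Ioc t₁ t₂ ×ˢ Ioc 0 R) := by
  have hprod : (volume : Measure (ℝ × ℝ)).restrict (Ioc t₁ t₂ ×ˢ Ioc 0 R)
      = (volume.restrict (Ioc t₁ t₂)).prod (volume.restrict (Ioc 0 R)) :=
    (Measure.prod_restrict _ _).symm
  rw [IntegrableOn, hprod]
  rw [hprod] at hE
  rw [integrable_prod_iff hE]
  refine ⟨ae_restrict_of_forall_mem measurableSet_Ioc fun t ht => (hslice t ht).1, ?_⟩
  refine (integrable_const A).mono' hE.norm.integral_prod_right' ?_
  refine ae_restrict_of_forall_mem measurableSet_Ioc fun t ht => ?_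
  rw [Real.norm_of_nonneg (integral_nonneg fun _ => norm_nonneg _)]
  refine le_trans (le_of_eq ?_) (hslice t ht).2
  exact setIntegral_congr_fun measurableSet_Ioc fun r hr => Real.norm_of_nonneg (h0 t ht r hr)

lemma abs_le_one_add_rpow (x : ℝ) : |x| ≤ 1 + |x| ^ (4 / 3 : ℝ) := by
  rcases le_total |x| 1 with h | h
  · linarith [Real.rpow_nonneg (abs_nonneg x) (4 / 3 : ℝ)]
  · linarith [Real.self_le_rpow_of_one_le h (by norm_num : (1 : ℝ) ≤ 4 / 3)]

end RadialMomentum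

/-- (Lemma 4.1: the radial weak momentum identity extends to test functions up to the origin)
If the weak momentum identity holds for all `C¹` test functions vanishing near the origin and
at `r = R`, then under the stated energy and integrability bounds it holds for all `C¹`
test functions `φ` with `φ(t,0) = φ(t,R) = 0`. -/
theorem radial_momentum_identity_extension
    (t₁ t₂ R K ν : ℝ) (ht₁ : 0 ≤ t₁) (ht : t₁ < t₂) (hR : 0 < R) (hK : 0 < K) (hν : 0 < ν)
    (ρ θ f u ur : ℝ → ℝ → ℝ)
    (hρm : Measurable (Function.uncurry ρ)) (hθm : Measurable (Function.uncurry θ))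
    (hfm : Measurable (Function.uncurry f))
    (hρ0 : ∀ t ∈ Icc t₁ t₂, ∀ r ∈ Ioc (0:ℝ) R, 0 ≤ ρ t r)
    (hθ0 : ∀ t ∈ Icc t₁ t₂, ∀ r ∈ Ioc (0:ℝ) R, 0 ≤ θ t r)
    (huc : ContinuousOn (Function.uncurry u) (Icc t₁ t₂ ×ˢ Ioc 0 R))
    (hur : ∀ t ∈ Icc t₁ t₂, ∀ r ∈ Ioc (0:ℝ) R, HasDerivAt (fun x => u t x) (ur t r) r)
    (hurc : ∀ t ∈ Icc t₁ t₂, ContinuousOn (fun x => ur t x) (Ioc 0 R))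
    (energy : ∃ A : ℝ, ∀ t ∈ Icc t₁ t₂,
      IntegrableOn (fun r => ρ t r * (1 + (u t r) ^ 2 + θ t r) * r) (Ioc 0 R) ∧
      (∫ r in Ioc (0:ℝ) R, ρ t r * (1 + (u t r) ^ 2 + θ t r) * r) ≤ A)
    (hgrad : IntegrableOn
      (fun q : ℝ × ℝ => (|ur q.1 q.2| ^ (4/3 : ℝ) + |u q.1 q.2 / q.2| ^ (4/3 : ℝ)) * q.2)
      (Icc t₁ t₂ ×ˢ Ioc 0 R))
    (hforce : IntegrableOn (fun q : ℝ × ℝ => ρ q.1 q.2 * |f q.1 q.2| * q.2)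
      (Icc t₁ t₂ ×ˢ Ioc 0 R))
    (hyp : ∀ b : ℝ, 0 < b → ∀ ψ : ℝ × ℝ → ℝ, ContDiff ℝ 1 ψ →
      (∀ t ∈ Icc t₁ t₂, ∀ r ∈ Icc (0:ℝ) b, ψ (t, r) = 0) →
      (∀ t ∈ Icc t₁ t₂, ψ (t, R) = 0) →
      momentumWeakForm t₁ t₂ R K ν ρ θ f u ur ψ) :
    ∀ φ : ℝ × ℝ → ℝ, ContDiff ℝ 1 φ →
      (∀ t ∈ Icc t₁ t₂, φ (t, 0) = 0 ∧ φ (t, R) = 0) →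
      momentumWeakForm t₁ t₂ R K ν ρ θ f u ur φ := by
  intro φ hφ hφ0
  obtain ⟨A, hA⟩ := energy
  obtain ⟨ψ, M, hM, hψ, hψnear, hψzero, hψbound, hψlim⟩ :=
    RadialMomentum.exists_cutoff_approximation (R := R) hφ fun t h => (hφ0 t h).1
  have hident : ∀ n, momentumWeakForm t₁ t₂ R K ν ρ θ f u ur (ψ n) := fun n =>
    hyp (1 / ((n : ℝ) + 1)) Nat.one_div_pos_of_nat (ψ n) (hψ n)
      (fun t _ r hr => hψnear n t r hr) fun t h => hψzero n _ (hφ0 t h).2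
  have hS : MeasurableSet (Ioc t₁ t₂ ×ˢ Ioc 0 R) := measurableSet_Ioc.prod measurableSet_Ioc
  have hsub : Ioc t₁ t₂ ×ˢ Ioc 0 R ⊆ Icc t₁ t₂ ×ˢ Ioc 0 R :=
    prod_mono Ioc_subset_Icc_self Subset.rfl
  let μ : Measure (ℝ × ℝ) := volume.restrict (Ioc t₁ t₂ ×ˢ Ioc 0 R)
  have mρ : AEStronglyMeasurable (fun q : ℝ × ℝ => ρ q.1 q.2) μ := hρm.aestronglyMeasurable
  have mθ : AEStronglyMeasurable (fun q : ℝ × ℝ => θ q.1 q.2) μ := hθm.aestronglyMeasurable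
  have mf : AEStronglyMeasurable (fun q : ℝ × ℝ => f q.1 q.2) μ := hfm.aestronglyMeasurable
  have mu : AEStronglyMeasurable (fun q : ℝ × ℝ => u q.1 q.2) μ :=
    (huc.mono hsub).aestronglyMeasurable hS
  have mur : AEStronglyMeasurable (fun q : ℝ × ℝ => ur q.1 q.2) μ :=
    RadialMomentum.aestronglyMeasurable_spatial_deriv huc hur
  have mr : AEStronglyMeasurable (fun q : ℝ × ℝ => q.2) μ := continuous_snd.aestronglyMeasurable
  have mψ : ∀ n, AEStronglyMeasurable (fun q : ℝ × ℝ => ψ n (q.1, q.2)) μ := fun n =>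
    (hψ n).continuous.aestronglyMeasurable
  have mψt : ∀ n, AEStronglyMeasurable
      (fun q : ℝ × ℝ => deriv (fun s => ψ n (s, q.2)) q.1) μ := fun n =>
    (RadialMomentum.continuous_deriv_fst_slice (hψ n)).aestronglyMeasurable
  have mψr : ∀ n, AEStronglyMeasurable
      (fun q : ℝ × ℝ => deriv (fun x => ψ n (q.1, x)) q.2) μ := fun n =>
    (RadialMomentum.continuous_deriv_snd_slice (hψ n)).aestronglyMeasurable
  have mdiv : ∀ n, AEStronglyMeasurable
      (fun q : ℝ × ℝ => deriv (fun x => ψ n (q.1, x)) q.2 + ψ n (q.1, q.2) / q.2) μ := fun n =>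
    (mψr n).add ((mψ n).div₀ mr)
  have hdiv : ∀ n, ∀ t ∈ Icc t₁ t₂, ∀ r ∈ Ioc 0 R,
      |deriv (fun x => ψ n (t, x)) r + ψ n (t, r) / r| ≤ 2 * M := fun n t h r hr => by
    obtain ⟨h₁, -, h₃⟩ := hψbound n t h r (Ioc_subset_Icc_self hr)
    have : |ψ n (t, r) / r| ≤ M := by
      rw [abs_div, abs_of_pos hr.1]
      exact (div_le_iff₀ hr.1).2 h₁
    linarith [abs_add_le (deriv (fun x => ψ n (t, x)) r) (ψ n (t, r) / r)]
  have hMR : ∀ n, ∀ t ∈ Icc t₁ t₂, ∀ r ∈ Ioc 0 R, |ψ n (t, r)| ≤ M * R := fun n t h r hr =>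
    (hψbound n t h r (Ioc_subset_Icc_self hr)).1.trans (mul_le_mul_of_nonneg_left hr.2 hM)
  have habs : ∀ x : ℝ, |x| ≤ 1 + x ^ 2 := fun x => by
    nlinarith [sq_abs x, sq_nonneg (|x| - 1), abs_nonneg x]
  have henergy : IntegrableOn
      (fun q : ℝ × ℝ => ρ q.1 q.2 * (1 + (u q.1 q.2) ^ 2 + θ q.1 q.2) * q.2)
      (Ioc t₁ t₂ ×ˢ Ioc 0 R) := by
    refine RadialMomentum.integrableOn_prod_of_slice_bound (A := A)
      ((mρ.mul ((aestronglyMeasurable_const.add (mu.pow 2)).add mθ)).mul mr)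
      (fun t h r hr => ?_) fun t h => hA t (Ioc_subset_Icc_self h)
    have := hρ0 t (Ioc_subset_Icc_self h) r hr
    have := hθ0 t (Ioc_subset_Icc_self h) r hr
    have := hr.1
    positivity
  have hslice : ∀ t ∈ Icc t₁ t₂, Tendsto
      (fun n => ∫ r in (0 : ℝ)..R, ρ t r * u t r * ψ n (t, r) * r) atTop
      (𝓝 (∫ r in (0 : ℝ)..R, ρ t r * u t r * φ (t, r) * r)) := by
    intro t h
    simp_rw [intervalIntegral.integral_of_le hR.le]
    refine tendsto_integral_of_dominated_convergence
      (fun r => M * R * (ρ t r * (1 + (u t r) ^ 2 + θ t r) * r)) (fun n => ?_)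
      ((hA t h).1.const_mul _) (fun n => ?_) ?_
    · have hut : ContinuousOn (fun x => u t x) (Ioc 0 R) := fun r hr =>
        (hur t h r hr).continuousAt.continuousWithinAt
      exact (((hρm.comp measurable_prodMk_left).aestronglyMeasurable.mul
        (hut.aestronglyMeasurable measurableSet_Ioc)).mul
        ((hψ n).continuous.comp (Continuous.prodMk_right t)).aestronglyMeasurable).mul
        continuous_id.aestronglyMeasurable
    · refine ae_restrict_of_forall_mem measurableSet_Ioc fun r hr => ?_
      have hρ := hρ0 t h r hr
      have hθ := hθ0 t h r hr
      have hr0 := hr.1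
      have hu : |u t r| ≤ 1 + u t r ^ 2 + θ t r := by linarith [habs (u t r)]
      rw [Real.norm_eq_abs, abs_mul, abs_mul, abs_mul, abs_of_nonneg hρ, abs_of_pos hr0]
      calc ρ t r * |u t r| * |ψ n (t, r)| * r
          ≤ ρ t r * (1 + u t r ^ 2 + θ t r) * (M * R) * r := by
            gcongr
            exact hMR n t h r hr
        _ = _ := by ring
    · refine ae_restrict_of_forall_mem measurableSet_Ioc fun r hr => ?_
      refine tendsto_nhds_of_eventually_eq ?_
      filter_upwards [hψlim r hr.1] with n hn
      rw [(hn t).1]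
  have hinertia := RadialMomentum.tendsto_iterated_integral ht.le hR.le
    (F := fun n q => (ρ q.1 q.2 * u q.1 q.2 * deriv (fun s => ψ n (s, q.2)) q.1
          + ρ q.1 q.2 * (u q.1 q.2) ^ 2 * deriv (fun x => ψ n (q.1, x)) q.2
          + K * ρ q.1 q.2 * θ q.1 q.2
            * (deriv (fun x => ψ n (q.1, x)) q.2 + ψ n (q.1, q.2) / q.2)) * q.2)
    (G := fun q => (ρ q.1 q.2 * u q.1 q.2 * deriv (fun s => φ (s, q.2)) q.1
          + ρ q.1 q.2 * (u q.1 q.2) ^ 2 * deriv (fun x => φ (q.1, x)) q.2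
          + K * ρ q.1 q.2 * θ q.1 q.2
            * (deriv (fun x => φ (q.1, x)) q.2 + φ (q.1, q.2) / q.2)) * q.2)
    (fun n => (((((mρ.mul mu).mul (mψt n)).add ((mρ.mul (mu.pow 2)).mul (mψr n))).add
      (((mρ.const_mul K).mul mθ).mul (mdiv n))).mul mr))
    (henergy.const_mul (2 * M + 2 * K * M))
    (by
      rintro n ⟨t, r⟩ ⟨h, hr⟩
      have h' : t ∈ Icc t₁ t₂ := Ioc_subset_Icc_self h
      have hρ := hρ0 t h' r hr
      have hθ := hθ0 t h' r hr
      have hr0 := hr.1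
      obtain ⟨-, h₂, h₃⟩ := hψbound n t h' r (Ioc_subset_Icc_self hr)
      have h₄ := hdiv n t h' r hr
      have hu := habs (u t r)
      dsimp only at h₂ h₃ h₄ ⊢
      rw [Real.norm_eq_abs, abs_mul, abs_of_pos hr0]
      have e₁ : |ρ t r * u t r * deriv (fun s => ψ n (s, r)) t| ≤ ρ t r * (1 + u t r ^ 2) * M := by
        rw [abs_mul, abs_mul, abs_of_nonneg hρ]
        gcongr
      have e₂ : |ρ t r * u t r ^ 2 * deriv (fun x => ψ n (t, x)) r| ≤ ρ t r * u t r ^ 2 * M := by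
        rw [abs_mul, abs_of_nonneg (by positivity : 0 ≤ ρ t r * u t r ^ 2)]
        gcongr
      have e₃ : |K * ρ t r * θ t r * (deriv (fun x => ψ n (t, x)) r + ψ n (t, r) / r)|
          ≤ K * ρ t r * θ t r * (2 * M) := by
        rw [abs_mul, abs_of_nonneg (by positivity : 0 ≤ K * ρ t r * θ t r)]
        gcongr
      calc _ ≤ (ρ t r * (1 + u t r ^ 2) * M + ρ t r * u t r ^ 2 * M
              + K * ρ t r * θ t r * (2 * M)) * r := by
            gcongr
            exact (abs_add_three _ _ _).trans (add_le_add_three e₁ e₂ e₃)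
        _ ≤ (2 * M + 2 * K * M) * (ρ t r * (1 + u t r ^ 2 + θ t r) * r) := by
            rw [← sub_nonneg]
            have : (2 * M + 2 * K * M) * (ρ t r * (1 + u t r ^ 2 + θ t r) * r)
                - (ρ t r * (1 + u t r ^ 2) * M + ρ t r * u t r ^ 2 * M
                  + K * ρ t r * θ t r * (2 * M)) * r
                = ρ t r * r * M * (1 + 2 * θ t r + 2 * K * (1 + u t r ^ 2)) := by ring
            rw [this]
            positivity)
    (by
      rintro ⟨t, r⟩ ⟨-, hr⟩
      filter_upwards [hψlim r hr.1] with n hn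
      rw [(hn t).1, (hn t).2.1, (hn t).2.2])
  have hforcing := RadialMomentum.tendsto_iterated_integral ht.le hR.le
    (F := fun n q => ρ q.1 q.2 * f q.1 q.2 * ψ n (q.1, q.2) * q.2)
    (G := fun q => ρ q.1 q.2 * f q.1 q.2 * φ (q.1, q.2) * q.2)
    (fun n => ((mρ.mul mf).mul (mψ n)).mul mr)
    ((hforce.mono_set hsub).const_mul (M * R))
    (by
      rintro n ⟨t, r⟩ ⟨h, hr⟩
      have h' : t ∈ Icc t₁ t₂ := Ioc_subset_Icc_self h
      have hρ := hρ0 t h' r hr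
      have hr0 := hr.1
      dsimp only
      rw [Real.norm_eq_abs, abs_mul, abs_mul, abs_mul, abs_of_nonneg hρ, abs_of_pos hr0]
      calc ρ t r * |f t r| * |ψ n (t, r)| * r ≤ ρ t r * |f t r| * (M * R) * r := by
            gcongr
            exact hMR n t h' r hr
        _ = _ := by ring)
    (by
      rintro ⟨t, r⟩ ⟨-, hr⟩
      filter_upwards [hψlim r hr.1] with n hn
      rw [(hn t).1])
  have hrint : IntegrableOn (fun q : ℝ × ℝ => q.2) (Ioc t₁ t₂ ×ˢ Ioc 0 R) :=
    (continuous_snd.continuousOn.integrableOn_compact (isCompact_Icc.prod isCompact_Icc)).mono_set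
      (prod_mono Ioc_subset_Icc_self Ioc_subset_Icc_self)
  have hviscous := RadialMomentum.tendsto_iterated_integral ht.le hR.le
    (F := fun n q => (ur q.1 q.2 + u q.1 q.2 / q.2)
      * (deriv (fun x => ψ n (q.1, x)) q.2 + ψ n (q.1, q.2) / q.2) * q.2)
    (G := fun q => (ur q.1 q.2 + u q.1 q.2 / q.2)
      * (deriv (fun x => φ (q.1, x)) q.2 + φ (q.1, q.2) / q.2) * q.2)
    (fun n => ((mur.add (mu.div₀ mr)).mul (mdiv n)).mul mr)
    (((hrint.const_mul 2).add (hgrad.mono_set hsub)).const_mul (2 * M))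
    (by
      rintro n ⟨t, r⟩ ⟨h, hr⟩
      have h' : t ∈ Icc t₁ t₂ := Ioc_subset_Icc_self h
      have hr0 := hr.1
      have h₄ := hdiv n t h' r hr
      have hsum : |ur t r + u t r / r|
          ≤ 2 + (|ur t r| ^ (4 / 3 : ℝ) + |u t r / r| ^ (4 / 3 : ℝ)) := by
        linarith [abs_add_le (ur t r) (u t r / r),
          RadialMomentum.abs_le_one_add_rpow (ur t r),
          RadialMomentum.abs_le_one_add_rpow (u t r / r)]
      simp only [Pi.add_apply]
      rw [Real.norm_eq_abs, abs_mul, abs_mul, abs_of_pos hr0]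
      calc _ ≤ (2 + (|ur t r| ^ (4 / 3 : ℝ) + |u t r / r| ^ (4 / 3 : ℝ))) * (2 * M) * r := by
            gcongr
        _ = _ := by ring)
    (by
      rintro ⟨t, r⟩ ⟨-, hr⟩
      filter_upwards [hψlim r hr.1] with n hn
      rw [(hn t).1, (hn t).2.2])
  exact tendsto_nhds_unique_of_eventuallyEq
    (((hslice t₂ (right_mem_Icc.2 ht.le)).sub (hslice t₁ (left_mem_Icc.2 ht.le))).sub hinertia)
    (hforcing.sub (hviscous.const_mul ν)) (Eventually.of_forall hident)
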